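/- arXiv:math/0611166 — 3 statements merged into one kernel-verified Lean document; each statement's English description precedes it below -/
import Mathlib

section
/- A function F : ℝ^n → [0,1] is a joint cumulative distribution function with one-dimensional marginal cdfs F_1,…,F_n and absolutely continuous with respect to the product ∏_{k=1}^n F_k if and only if there exist Borel functions g_{i_1,…,i_c} : ℝ^c → ℝ, 1 ≤ i_1 < ⋯ < i_c ≤ n, c = 2,…,n, satisfying conditions A1–A3 such that F(x_1,…,x_n) = ∫_{−∞}^{x_1}⋯∫_{−∞}^{x_n} (1 + U_n(t_1,…,t_n)) dF_1(t_1)⋯dF_n(t_n). Moreover the kernels are unique: necessarily g_{i_1,…,i_c}(ξ_{i_1},…,ξ_{i_c}) = f_{i_1,…,i_c}(ξ_{i_1},…,ξ_{i_c}) almost surely, where f_{i_1,…,i_c}(x_{i_1},…,x_{i_c}) = Σ_{k=2}^{c} (−1)^{c−k} Σ_{j_1<⋯<j_k ∈ {i_1,…,i_c}} ( dF(x_{j_1},…,x_{j_k})/(dF_{j_1}⋯dF_{j_k}) − 1 ), with dF(x_{j_1},…,x_{j_k})/(dF_{j_1}⋯dF_{j_k}) denoting the density of the k-dimensional marginal of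 F with respect to the product of its marginals. -/
open MeasureTheory Finset

/-- A function `g` on `ℝⁿ` depends only on the coordinates in `S`
(i.e., it is really a function of the variables `x_i`, `i ∈ S`). -/
def DependsOnlyOn {n : ℕ} (S : Finset (Fin n)) (g : (Fin n → ℝ) → ℝ) : Prop :=
  ∀ x y : Fin n → ℝ, (∀ i ∈ S, x i = y i) → g x = g y

/-- The sum of U-statistics `U_n(x) = Σ_{c=2}^n Σ_{i_1<⋯<i_c} g_{i_1,…,i_c}(x_{i_1},…,x_{i_c})`,
where the kernel for the index set `S = {i_1,…,i_c}` is `g S`. -/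
noncomputable def Usum {n : ℕ} (g : Finset (Fin n) → (Fin n → ℝ) → ℝ) (x : Fin n → ℝ) : ℝ :=
  ∑ S ∈ Finset.univ.filter (fun S : Finset (Fin n) => 2 ≤ S.card), g S x

/-- Conditions A1 (integrability), A2 (degeneracy: zero mean in each argument, a.s. in
the remaining arguments) and A3 (positive definiteness: `U_n ≥ -1` a.s.) for a family of
Borel kernels `g_{i_1,…,i_c}`, with respect to independent random variables `ξ_1,…,ξ_n`
with distributions `μ_1,…,μ_n` (whose joint law is `Measure.pi μ`). -/
def IsKernelSystem {n : ℕ} (μ : Fin n → Measure ℝ) (g : Finset (Fin n) → (Fin n → ℝ) → ℝ) :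
    Prop :=
  (∀ S : Finset (Fin n), 2 ≤ S.card →
      Measurable (g S) ∧ DependsOnlyOn S (g S) ∧
      Integrable (g S) (Measure.pi μ) ∧
      ∀ k ∈ S, ∀ᵐ x ∂Measure.pi μ, ∫ t, g S (Function.update x k t) ∂μ k = 0) ∧
  (∀ᵐ x ∂Measure.pi μ, -1 ≤ Usum g x)

/-- The density of the `T`-marginal of `ν` with respect to the product of the corresponding
one-dimensional marginals `μ_i`, `i ∈ T`, viewed as a function on `ℝⁿ`: it is the conditional
expectation, under the product measure `Measure.pi μ`, of the joint density `dν/d(Πμ)` given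
the σ-algebra generated by the coordinates in `T`. -/
noncomputable def marginalDensity {n : ℕ} (μ : Fin n → Measure ℝ) (ν : Measure (Fin n → ℝ))
    (T : Finset (Fin n)) : (Fin n → ℝ) → ℝ :=
  (Measure.pi μ)[(fun y => (ν.rnDeriv (Measure.pi μ) y).toReal) |
    MeasurableSpace.comap (fun y : Fin n → ℝ => fun i : T => y (i : Fin n)) inferInstance]

section Moebius

variable {α : Type*} [DecidableEq α]

theorem sum_powerset_neg_one_pow_mul_sum_powerset (G : Finset α → ℝ) (S : Finset α) :
    ∑ T ∈ S.powerset, (-1 : ℝ) ^ (S.card + T.card) * ∑ R ∈ T.powerset, G R = G S := by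
  induction S using Finset.induction_on generalizing G with
  | empty => simp
  | insert a S ha ih =>
    rw [sum_powerset_insert ha, ← ih fun R => G (insert a R), ← sum_add_distrib]
    refine sum_congr rfl fun T hT => ?_
    have haT : a ∉ T := fun h => ha (mem_powerset.1 hT h)
    rw [sum_powerset_insert haT, card_insert_of_notMem ha, card_insert_of_notMem haT]
    ring

theorem sum_powerset_sum_powerset_neg_one_pow_mul (h : Finset α → ℝ) (S : Finset α) :
    ∑ R ∈ S.powerset, ∑ T ∈ R.powerset, (-1 : ℝ) ^ (R.card + T.card) * h T = h S := by
  induction S using Finset.induction_on generalizing h with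
  | empty => simp
  | insert a S ha ih =>
    rw [sum_powerset_insert ha, ← ih fun R => h (insert a R), ← sum_add_distrib]
    refine sum_congr rfl fun R hR => ?_
    have haR : a ∉ R := fun h => ha (mem_powerset.1 hR h)
    rw [sum_powerset_insert haR, ← add_assoc, ← sum_add_distrib, ← sum_add_distrib]
    refine sum_congr rfl fun T hT => ?_
    have haT : a ∉ T := fun h => haR (mem_powerset.1 hT h)
    rw [card_insert_of_notMem haR, card_insert_of_notMem haT]
    ring

theorem sum_powerset_neg_one_pow_mul_erase (h : Finset α → ℝ) {S : Finset α} {k : α}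
    (hk : k ∈ S) :
    ∑ T ∈ S.powerset, (-1 : ℝ) ^ (S.card + T.card) * h (T.erase k) = 0 := by
  rw [← insert_erase hk, sum_powerset_insert (notMem_erase k S), ← sum_add_distrib]
  refine sum_eq_zero fun T hT => ?_
  have hkT : k ∉ T := fun h => notMem_erase k S (mem_powerset.1 hT h)
  rw [card_insert_of_notMem hkT, erase_insert hkT, erase_eq_of_notMem hkT]
  ring

end Moebius

theorem MeasureTheory.MeasurePreserving.integral_comp_of_aestronglyMeasurable
    {α β : Type*} [MeasurableSpace α] [MeasurableSpace β] {μ : Measure α} {ν : Measure β}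
    {φ : α → β} (hφ : MeasurePreserving φ μ ν) {f : β → ℝ} (hf : AEStronglyMeasurable f ν) :
    ∫ x, f (φ x) ∂μ = ∫ y, f y ∂ν := by
  rw [← hφ.map_eq] at hf ⊢
  exact (integral_map hφ.aemeasurable hf).symm

section CoordMean

variable {ι : Type*} [DecidableEq ι] {X : ι → Type*} [∀ i, MeasurableSpace (X i)]

theorem measurable_finset_piecewise (T : Finset ι) :
    Measurable fun p : (∀ i, X i) × (∀ i, X i) => T.piecewise p.1 p.2 := by
  refine measurable_pi_lambda _ fun i => ?_
  by_cases hi : i ∈ T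
  · simp only [hi, piecewise_eq_of_mem]
    fun_prop
  · simp only [hi, not_false_eq_true, piecewise_eq_of_notMem]
    fun_prop

variable [Fintype ι]

/-- The mean of `f` over the coordinates outside `T`, as a function of all coordinates. -/
noncomputable def coordMean (μ : ∀ i, Measure (X i)) (T : Finset ι) (f : (∀ i, X i) → ℝ)
    (x : ∀ i, X i) : ℝ :=
  ∫ y, f (T.piecewise x y) ∂Measure.pi μ

theorem coordMean_empty (μ : ∀ i, Measure (X i)) (f : (∀ i, X i) → ℝ) (x : ∀ i, X i) :
    coordMean μ ∅ f x = ∫ y, f y ∂Measure.pi μ := by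
  simp [coordMean]

variable (μ : ∀ i, Measure (X i)) [∀ i, IsProbabilityMeasure (μ i)]

theorem measurePreserving_finset_piecewise (T : Finset ι) :
    MeasurePreserving (fun p : (∀ i, X i) × (∀ i, X i) => T.piecewise p.1 p.2)
      ((Measure.pi μ).prod (Measure.pi μ)) (Measure.pi μ) := by
  refine ⟨measurable_finset_piecewise T, (Measure.pi_eq fun s hs => ?_).symm⟩
  rw [Measure.map_apply (measurable_finset_piecewise T) (MeasurableSet.univ_pi hs)]
  have : (fun p : (∀ i, X i) × (∀ i, X i) => T.piecewise p.1 p.2) ⁻¹' Set.univ.pi s =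
      (Set.univ.pi fun i => if i ∈ T then s i else Set.univ) ×ˢ
        (Set.univ.pi fun i => if i ∈ T then Set.univ else s i) := by
    ext p
    simp only [Set.mem_preimage, Set.mem_univ_pi, Set.mem_prod, ← forall_and]
    refine forall_congr' fun i => ?_
    by_cases hi : i ∈ T <;> simp [hi]
  rw [this, Measure.prod_prod, Measure.pi_pi, Measure.pi_pi, ← prod_mul_distrib]
  refine prod_congr rfl fun i _ => ?_
  by_cases hi : i ∈ T <;> simp [hi]

variable {μ}

theorem integrable_comp_finset_piecewise (T : Finset ι) {f : (∀ i, X i) → ℝ}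
    (hf : Integrable f (Measure.pi μ)) :
    Integrable (fun p : (∀ i, X i) × (∀ i, X i) => f (T.piecewise p.1 p.2))
      ((Measure.pi μ).prod (Measure.pi μ)) :=
  (measurePreserving_finset_piecewise μ T).integrable_comp_of_integrable hf

theorem integrable_coordMean (T : Finset ι) {f : (∀ i, X i) → ℝ}
    (hf : Integrable f (Measure.pi μ)) : Integrable (coordMean μ T f) (Measure.pi μ) :=
  (integrable_comp_finset_piecewise T hf).integral_prod_left

theorem measurable_coordMean (T : Finset ι) {f : (∀ i, X i) → ℝ} (hf : Measurable f) :
    Measurable (coordMean μ T f) :=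
  (StronglyMeasurable.integral_prod_right (f := fun x y => f (T.piecewise x y))
    (hf.comp (measurable_finset_piecewise T)).stronglyMeasurable).measurable

theorem coordMean_congr_ae (T : Finset ι) {f g : (∀ i, X i) → ℝ} (h : f =ᵐ[Measure.pi μ] g) :
    coordMean μ T f =ᵐ[Measure.pi μ] coordMean μ T g := by
  have := (measurePreserving_finset_piecewise μ T).quasiMeasurePreserving.ae_eq_comp h
  filter_upwards [Measure.ae_ae_of_ae_prod this] with x hx
  exact integral_congr_ae hx

theorem coordMean_finset_sum {κ : Type*} (s : Finset κ) (T : Finset ι) {f : κ → (∀ i, X i) → ℝ}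
    (hf : ∀ a ∈ s, Integrable (f a) (Measure.pi μ)) :
    coordMean μ T (fun x => ∑ a ∈ s, f a x) =ᵐ[Measure.pi μ]
      fun x => ∑ a ∈ s, coordMean μ T (f a) x := by
  have : ∀ᵐ x ∂Measure.pi μ, ∀ a ∈ s,
      Integrable (fun y => f a (T.piecewise x y)) (Measure.pi μ) :=
    (ae_ball_iff s.countable_toSet).2 fun a ha =>
      (integrable_comp_finset_piecewise T (hf a ha)).prod_right_ae
  filter_upwards [this] with x hx
  exact integral_finsetSum s hx

theorem coordMean_add {f g : (∀ i, X i) → ℝ} (T : Finset ι) (hf : Integrable f (Measure.pi μ))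
    (hg : Integrable g (Measure.pi μ)) :
    coordMean μ T (fun x => f x + g x) =ᵐ[Measure.pi μ]
      fun x => coordMean μ T f x + coordMean μ T g x := by
  filter_upwards [(integrable_comp_finset_piecewise T hf).prod_right_ae,
    (integrable_comp_finset_piecewise T hg).prod_right_ae] with x hx hy
  exact integral_add hx hy

theorem coordMean_coordMean (T R : Finset ι) {f : (∀ i, X i) → ℝ}
    (hf : Integrable f (Measure.pi μ)) :
    coordMean μ T (coordMean μ R f) =ᵐ[Measure.pi μ] coordMean μ (R ∩ T) f := by
  filter_upwards [(integrable_comp_finset_piecewise (R ∩ T) hf).prod_right_ae] with x hx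
  have hmp := measurePreserving_finset_piecewise μ R
  have hpw : ∀ y z : ∀ i, X i, R.piecewise (T.piecewise x y) z =
      (R ∩ T).piecewise x (R.piecewise y z) := by
    intro y z
    ext i
    by_cases hR : i ∈ R <;> by_cases hT : i ∈ T <;> simp [hR, hT]
  have hint := integrable_comp_finset_piecewise R hx
  simp only [coordMean, hpw]
  rw [← integral_prod _ hint]
  exact hmp.integral_comp_of_aestronglyMeasurable hx.aestronglyMeasurable

theorem coordMean_univ (f : (∀ i, X i) → ℝ) : coordMean μ univ f = f := by
  ext x
  simp [coordMean]

theorem coordMean_compl_singleton (k : ι) {f : (∀ i, X i) → ℝ} (hf : Measurable f)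
    (x : ∀ i, X i) : coordMean μ {k}ᶜ f x = ∫ t, f (Function.update x k t) ∂μ k := by
  rw [← (measurePreserving_eval μ k).integral_comp_of_aestronglyMeasurable
    (f := fun t => f (Function.update x k t)) (hf.comp (measurable_update x)).aestronglyMeasurable]
  refine integral_congr_ae (.of_forall fun y => congrArg f ?_)
  ext i
  by_cases hi : i = k
  · subst hi
    simp
  · simp [hi]

theorem setIntegral_coordMean (T : Finset ι) {f : (∀ i, X i) → ℝ}
    (hf : Integrable f (Measure.pi μ)) {s : Set (∀ i, X i)} (hs : MeasurableSet s)
    (hsT : ∀ x y, T.piecewise x y ∈ s ↔ x ∈ s) :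
    ∫ x in s, coordMean μ T f x ∂Measure.pi μ = ∫ x in s, f x ∂Measure.pi μ := by
  have hmp := measurePreserving_finset_piecewise μ T
  have hfs := hf.indicator hs
  rw [← integral_indicator hs, ← integral_indicator hs]
  calc ∫ x, s.indicator (coordMean μ T f) x ∂Measure.pi μ
      = ∫ x, ∫ y, s.indicator f (T.piecewise x y) ∂Measure.pi μ ∂Measure.pi μ := by
        refine integral_congr_ae (.of_forall fun x => ?_)
        by_cases hx : x ∈ s <;> simp [hx, hsT, coordMean, Set.indicator]
    _ = ∫ p, s.indicator f (T.piecewise p.1 p.2) ∂(Measure.pi μ).prod (Measure.pi μ) :=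
        (integral_prod _ (integrable_comp_finset_piecewise T hfs)).symm
    _ = ∫ x, s.indicator f x ∂Measure.pi μ :=
        hmp.integral_comp_of_aestronglyMeasurable hfs.aestronglyMeasurable

theorem coordMean_ae_eq_condExp (T : Finset ι) {f : (∀ i, X i) → ℝ} (hfm : Measurable f)
    (hf : Integrable f (Measure.pi μ)) :
    coordMean μ T f =ᵐ[Measure.pi μ] (Measure.pi μ)[f |
      MeasurableSpace.comap (fun y : ∀ i, X i => fun i : T => y (i : ι)) inferInstance] := by
  have hrm : Measurable (fun y : ∀ i, X i => fun i : T => y (i : ι)) :=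
    measurable_pi_lambda _ fun i => measurable_pi_apply _
  refine ae_eq_condExp_of_forall_setIntegral_eq hrm.comap_le hf
    (fun s _ _ => (integrable_coordMean T hf).integrableOn) ?_ ?_
  · rintro _ ⟨B, hB, rfl⟩ -
    refine setIntegral_coordMean T hf (hrm hB) fun x y => ?_
    have : (fun i : T => T.piecewise x y (i : ι)) = fun i : T => x i := by
      ext i
      simp
    simp only [Set.mem_preimage, this]
  · have : ∀ i, Nonempty (X i) := fun i => (μ i).nonempty_of_neZero
    let x₀ : ∀ i, X i := fun i => Classical.arbitrary _
    let ext₀ : (∀ i : T, X i) → ∀ i, X i := fun z i => if h : i ∈ T then z ⟨i, h⟩ else x₀ i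
    have hext : Measurable ext₀ := by
      refine measurable_pi_lambda _ fun i => ?_
      by_cases hi : i ∈ T
      · simpa [ext₀, hi] using measurable_pi_apply _
      · simp [ext₀, hi]
    have hfac : coordMean μ T f =
        (coordMean μ T f ∘ ext₀) ∘ fun y : ∀ i, X i => fun i : T => y (i : ι) := by
      ext x
      refine integral_congr_ae (.of_forall fun y => congrArg f ?_)
      ext i
      by_cases hi : i ∈ T <;> simp [ext₀, hi]
    rw [hfac]
    exact (((measurable_coordMean T hfm).comp hext).comp
      (comap_measurable _)).stronglyMeasurable.aestronglyMeasurable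

end CoordMean

theorem MeasureTheory.Measure.ext_of_Iic_pi {ι : Type*} [Finite ι] {ν ρ : Measure (ι → ℝ)}
    [IsProbabilityMeasure ν] [IsProbabilityMeasure ρ] (h : ∀ x, ν (Set.Iic x) = ρ (Set.Iic x)) :
    ν = ρ := by
  have hspan : ∀ _ : ι, IsCountablySpanning (Set.range (Set.Iic : ℝ → Set ℝ)) := fun _ =>
    ⟨fun k : ℕ => Set.Iic (k : ℝ), fun k => ⟨k, rfl⟩, Set.iUnion_eq_univ_iff.2 exists_nat_ge⟩
  refine ext_of_generate_finite _ (generateFrom_eq_pi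
    (fun _ => (borel_eq_generateFrom_Iic ℝ).symm.trans
      (BorelSpace.measurable_eq (α := ℝ)).symm) hspan).symm
    (IsPiSystem.pi fun _ => isPiSystem_Iic) ?_ (by simp)
  rintro _ ⟨s, hs, rfl⟩
  choose x hx using fun i => hs i (Set.mem_univ i)
  obtain rfl : (fun i => Set.Iic (x i)) = s := funext hx
  rw [Set.pi_univ_Iic]
  exact h x

section KernelSystem

variable {n : ℕ} {μ : Fin n → Measure ℝ} {g : Finset (Fin n) → (Fin n → ℝ) → ℝ}

theorem IsKernelSystem.measurable_Usum (hg : IsKernelSystem μ g) : Measurable (Usum g) :=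
  Finset.measurable_fun_sum _ fun R hR => (hg.1 R (mem_filter.1 hR).2).1

theorem IsKernelSystem.integrable_Usum (hg : IsKernelSystem μ g) :
    Integrable (Usum g) (Measure.pi μ) :=
  integrable_finsetSum _ fun R hR => (hg.1 R (mem_filter.1 hR).2).2.2.1

theorem IsKernelSystem.one_add_Usum_nonneg (hg : IsKernelSystem μ g) :
    ∀ᵐ x ∂Measure.pi μ, 0 ≤ 1 + Usum g x := by
  filter_upwards [hg.2] with x hx
  linarith

/-- The density of `ν` with respect to the product measure, as a real function. -/
noncomputable def productDensity (μ : Fin n → Measure ℝ) (ν : Measure (Fin n → ℝ))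
    (x : Fin n → ℝ) : ℝ :=
  (ν.rnDeriv (Measure.pi μ) x).toReal

theorem measurable_productDensity {ν : Measure (Fin n → ℝ)} : Measurable (productDensity μ ν) :=
  (Measure.measurable_rnDeriv _ _).ennreal_toReal

theorem integrable_productDensity {ν : Measure (Fin n → ℝ)} [IsProbabilityMeasure ν] :
    Integrable (productDensity μ ν) (Measure.pi μ) :=
  Measure.integrable_toReal_rnDeriv

variable [∀ i, IsProbabilityMeasure (μ i)]

theorem IsKernelSystem.coordMean_eq_self (hg : IsKernelSystem μ g) {R T : Finset (Fin n)}
    (hR : 2 ≤ R.card) (hRT : R ⊆ T) : coordMean μ T (g R) = g R := by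
  ext x
  have : ∀ y, g R (T.piecewise x y) = g R x := fun y =>
    (hg.1 R hR).2.1 _ _ fun i hi => by simp [hRT hi]
  simp [coordMean, this]

theorem IsKernelSystem.coordMean_ae_eq_zero (hg : IsKernelSystem μ g) {R T : Finset (Fin n)}
    (hR : 2 ≤ R.card) (hRT : ¬ R ⊆ T) : coordMean μ T (g R) =ᵐ[Measure.pi μ] 0 := by
  obtain ⟨k, hkR, hkT⟩ := not_subset.1 hRT
  obtain ⟨hm, -, hi, hdeg⟩ := hg.1 R hR
  have hzero : coordMean μ {k}ᶜ (g R) =ᵐ[Measure.pi μ] 0 := by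
    filter_upwards [hdeg k hkR] with x hx
    rw [coordMean_compl_singleton k hm, hx, Pi.zero_apply]
  have hT : {k}ᶜ ∩ T = T := inter_eq_right.2 fun i hi => by
    simpa using fun h : i = k => hkT (h ▸ hi)
  have hcomp := coordMean_coordMean T {k}ᶜ hi
  rw [hT] at hcomp
  filter_upwards [hcomp, coordMean_congr_ae T hzero] with x h₁ h₂
  rw [← h₁, h₂]
  simp [coordMean]

theorem IsKernelSystem.integrable_one_add_Usum (hg : IsKernelSystem μ g) :
    Integrable (fun x => 1 + Usum g x) (Measure.pi μ) :=
  (integrable_const 1).add hg.integrable_Usum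

theorem IsKernelSystem.coordMean_one_add_Usum (hg : IsKernelSystem μ g) (T : Finset (Fin n)) :
    coordMean μ T (fun x => 1 + Usum g x) =ᵐ[Measure.pi μ]
      fun x => 1 + ∑ R ∈ T.powerset, if 2 ≤ R.card then g R x else 0 := by
  have hterm : ∀ᵐ x ∂Measure.pi μ, ∀ R ∈ univ.filter (fun R : Finset (Fin n) => 2 ≤ R.card),
      coordMean μ T (g R) x = if R ⊆ T then g R x else 0 := by
    refine (ae_ball_iff (Finset.countable_toSet _)).2 fun R hR => ?_
    have hR' := (mem_filter.1 hR).2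
    by_cases hRT : R ⊆ T
    · simp [hRT, hg.coordMean_eq_self hR' hRT]
    · filter_upwards [hg.coordMean_ae_eq_zero hR' hRT] with x hx
      simp [hRT, hx]
  filter_upwards [hterm, coordMean_add T (integrable_const 1) hg.integrable_Usum,
    coordMean_finset_sum (univ.filter fun R : Finset (Fin n) => 2 ≤ R.card) T
      fun R hR => (hg.1 R (mem_filter.1 hR).2).2.2.1] with x h₁ h₂ h₃
  rw [h₂]
  congr 1
  · simp [coordMean]
  · refine h₃.trans ((sum_congr rfl h₁).trans ?_)
    rw [← sum_filter, ← sum_filter]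
    refine sum_congr ?_ fun _ _ => rfl
    ext R
    simp [and_comm]

theorem IsKernelSystem.setIntegral_one_add_Usum (hg : IsKernelSystem μ g) {T : Finset (Fin n)}
    (hT : T.card ≤ 1) {s : Set (Fin n → ℝ)} (hs : MeasurableSet s)
    (hsT : ∀ x y, T.piecewise x y ∈ s ↔ x ∈ s) :
    ∫ x in s, (1 + Usum g x) ∂Measure.pi μ = (Measure.pi μ).real s := by
  rw [← setIntegral_coordMean T hg.integrable_one_add_Usum hs hsT]
  have : coordMean μ T (fun x => 1 + Usum g x) =ᵐ[(Measure.pi μ).restrict s] fun _ => 1 := by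
    filter_upwards [ae_restrict_of_ae (hg.coordMean_one_add_Usum T)] with x hx
    rw [hx, sum_eq_zero, add_zero]
    intro R hR
    have := card_le_card (mem_powerset.1 hR)
    rw [if_neg (by lia)]
  rw [integral_congr_ae this]
  simp

/-- The measure with density `1 + U_n` with respect to the product measure. -/
noncomputable def kernelMeasure (μ : Fin n → Measure ℝ) (g : Finset (Fin n) → (Fin n → ℝ) → ℝ) :
    Measure (Fin n → ℝ) :=
  (Measure.pi μ).withDensity fun x => ENNReal.ofReal (1 + Usum g x)

theorem IsKernelSystem.kernelMeasure_apply (hg : IsKernelSystem μ g) {s : Set (Fin n → ℝ)}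
    (hs : MeasurableSet s) :
    kernelMeasure μ g s = ENNReal.ofReal (∫ x in s, (1 + Usum g x) ∂Measure.pi μ) := by
  rw [kernelMeasure, withDensity_apply _ hs, ofReal_integral_eq_lintegral_ofReal
    hg.integrable_one_add_Usum.integrableOn (ae_restrict_of_ae hg.one_add_Usum_nonneg)]

theorem IsKernelSystem.isProbabilityMeasure_kernelMeasure (hg : IsKernelSystem μ g) :
    IsProbabilityMeasure (kernelMeasure μ g) := by
  refine ⟨?_⟩
  rw [hg.kernelMeasure_apply .univ,
    hg.setIntegral_one_add_Usum (T := ∅) (by simp) .univ (by simp)]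
  simp

theorem IsKernelSystem.map_eval_kernelMeasure (hg : IsKernelSystem μ g) (i : Fin n) :
    (kernelMeasure μ g).map (fun x => x i) = μ i := by
  refine Measure.ext fun A hA => ?_
  have hs : MeasurableSet ((fun x : Fin n → ℝ => x i) ⁻¹' A) := measurable_pi_apply i hA
  rw [Measure.map_apply (measurable_pi_apply i) hA, hg.kernelMeasure_apply hs,
    hg.setIntegral_one_add_Usum (T := {i}) (by simp) hs (by simp), ofReal_measureReal]
  exact (measurePreserving_eval μ i).measure_preimage hA.nullMeasurableSet

theorem IsKernelSystem.toReal_kernelMeasure_Iic (hg : IsKernelSystem μ g) (x : Fin n → ℝ) :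
    (kernelMeasure μ g (Set.Iic x)).toReal = ∫ t in Set.Iic x, (1 + Usum g t) ∂Measure.pi μ := by
  rw [hg.kernelMeasure_apply measurableSet_Iic, ENNReal.toReal_ofReal]
  exact integral_nonneg_of_ae (ae_restrict_of_ae hg.one_add_Usum_nonneg)

theorem IsKernelSystem.productDensity_kernelMeasure (hg : IsKernelSystem μ g) :
    productDensity μ (kernelMeasure μ g) =ᵐ[Measure.pi μ] fun x => 1 + Usum g x := by
  filter_upwards [hg.one_add_Usum_nonneg, Measure.rnDeriv_withDensity (Measure.pi μ)
    (hg.measurable_Usum.const_add 1).ennreal_ofReal] with x h₁ h₂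
  rw [productDensity, kernelMeasure, h₂, ENNReal.toReal_ofReal h₁]

variable {ν : Measure (Fin n → ℝ)} [IsProbabilityMeasure ν]

theorem coordMean_productDensity_ae_eq_marginalDensity (T : Finset (Fin n)) :
    coordMean μ T (productDensity μ ν) =ᵐ[Measure.pi μ] marginalDensity μ ν T :=
  coordMean_ae_eq_condExp T measurable_productDensity integrable_productDensity

/-- The inclusion-exclusion kernel attached to the index set `S`. -/
noncomputable def densityKernel (μ : Fin n → Measure ℝ) (ν : Measure (Fin n → ℝ))
    (S : Finset (Fin n)) (x : Fin n → ℝ) : ℝ :=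
  ∑ T ∈ S.powerset, (-1 : ℝ) ^ (S.card + T.card) * (coordMean μ T (productDensity μ ν) x - 1)

theorem IsKernelSystem.ae_eq_densityKernel (hg : IsKernelSystem μ g) {S : Finset (Fin n)}
    (hS : 2 ≤ S.card) : g S =ᵐ[Measure.pi μ] densityKernel μ (kernelMeasure μ g) S := by
  have hT : ∀ᵐ x ∂Measure.pi μ, ∀ T,
      coordMean μ T (productDensity μ (kernelMeasure μ g)) x =
        1 + ∑ R ∈ T.powerset, if 2 ≤ R.card then g R x else 0 :=
    ae_all_iff.2 fun T => (coordMean_congr_ae T hg.productDensity_kernelMeasure).trans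
      (hg.coordMean_one_add_Usum T)
  filter_upwards [hT] with x hx
  simp only [densityKernel, hx, add_sub_cancel_left]
  rw [sum_powerset_neg_one_pow_mul_sum_powerset, if_pos hS]

theorem coordMean_productDensity_of_card_le_one (hν : ν ≪ Measure.pi μ)
    (hmarg : ∀ i, ν.map (fun x => x i) = μ i) {T : Finset (Fin n)} (hT : T.card ≤ 1) :
    coordMean μ T (productDensity μ ν) =ᵐ[Measure.pi μ] fun _ => 1 := by
  rcases Nat.le_one_iff_eq_zero_or_eq_one.1 hT with h | h
  · rw [card_eq_zero.1 h]
    refine .of_forall fun x => ?_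
    rw [coordMean_empty]
    exact (Measure.integral_toReal_rnDeriv hν).trans probReal_univ
  · obtain ⟨i, rfl⟩ := card_eq_one.1 h
    have hrm : Measurable (fun y : Fin n → ℝ => fun j : ({i} : Finset (Fin n)) => y j) :=
      measurable_pi_lambda _ fun j => measurable_pi_apply _
    refine (coordMean_ae_eq_condExp {i} measurable_productDensity
      integrable_productDensity).trans (ae_eq_condExp_of_forall_setIntegral_eq hrm.comap_le
        integrable_productDensity (fun s _ _ => integrableOn_const) ?_
        aestronglyMeasurable_const).symm
    rintro _ ⟨B, hB, rfl⟩ -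
    have hA : MeasurableSet {t : ℝ | (fun _ : ({i} : Finset (Fin n)) => t) ∈ B} :=
      (measurable_pi_lambda _ fun _ => measurable_id) hB
    have hs : (fun y : Fin n → ℝ => fun j : ({i} : Finset (Fin n)) => y j) ⁻¹' B =
        (fun y => y i) ⁻¹' {t : ℝ | (fun _ : ({i} : Finset (Fin n)) => t) ∈ B} := by
      ext y
      have : (fun j : ({i} : Finset (Fin n)) => y j) = fun _ => y i := by
        ext j
        rw [mem_singleton.1 j.2]
      simp [this]
    rw [hs]
    refine Eq.trans ?_ (Measure.setIntegral_toReal_rnDeriv hν _).symm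
    rw [setIntegral_const, smul_eq_mul, mul_one, measureReal_def, measureReal_def,
      ← Measure.map_apply (μ := ν) (measurable_pi_apply i) hA, hmarg i]
    exact congrArg _ ((measurePreserving_eval μ i).measure_preimage hA.nullMeasurableSet)

theorem integrable_densityKernel_term (S T : Finset (Fin n)) :
    Integrable (fun x => (-1 : ℝ) ^ (S.card + T.card) *
      (coordMean μ T (productDensity μ ν) x - 1)) (Measure.pi μ) :=
  ((integrable_coordMean T integrable_productDensity).sub (integrable_const 1)).const_mul _

theorem coordMean_compl_singleton_densityKernel {S : Finset (Fin n)} {k : Fin n} (hk : k ∈ S) :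
    coordMean μ {k}ᶜ (densityKernel μ ν S) =ᵐ[Measure.pi μ] 0 := by
  have hterm : ∀ᵐ x ∂Measure.pi μ, ∀ T ∈ S.powerset,
      coordMean μ {k}ᶜ (fun x => (-1 : ℝ) ^ (S.card + T.card) *
        (coordMean μ T (productDensity μ ν) x - 1)) x =
      (-1 : ℝ) ^ (S.card + T.card) * (coordMean μ (T.erase k) (productDensity μ ν) x - 1) := by
    refine (ae_ball_iff (Finset.countable_toSet _)).2 fun T _ => ?_
    have hcomp := coordMean_coordMean {k}ᶜ T (integrable_productDensity (μ := μ) (ν := ν))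
    rw [← sdiff_eq_inter_compl, sdiff_singleton_eq_erase] at hcomp
    filter_upwards [hcomp, (integrable_comp_finset_piecewise {k}ᶜ
      (integrable_coordMean (μ := μ) T
        (integrable_productDensity (ν := ν)))).prod_right_ae] with x h₁ h₂
    rw [← h₁, coordMean, integral_const_mul, integral_sub h₂ (integrable_const 1)]
    simp [coordMean]
  filter_upwards [hterm, coordMean_finset_sum S.powerset {k}ᶜ fun T _ =>
    integrable_densityKernel_term (μ := μ) (ν := ν) S T] with x h₁ h₂
  refine h₂.trans ((sum_congr rfl h₁).trans ?_)
  exact sum_powerset_neg_one_pow_mul_erase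
    (fun T => coordMean μ T (productDensity μ ν) x - 1) hk

theorem densityKernel_of_card_le_one (hν : ν ≪ Measure.pi μ)
    (hmarg : ∀ i, ν.map (fun x => x i) = μ i) {S : Finset (Fin n)} (hS : S.card ≤ 1) :
    densityKernel μ ν S =ᵐ[Measure.pi μ] 0 := by
  have hT : ∀ᵐ x ∂Measure.pi μ, ∀ T ∈ S.powerset, coordMean μ T (productDensity μ ν) x = 1 :=
    (ae_ball_iff (Finset.countable_toSet _)).2 fun T hT =>
      coordMean_productDensity_of_card_le_one hν hmarg
        ((card_le_card (mem_powerset.1 hT)).trans hS)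
  filter_upwards [hT] with x hx
  exact sum_eq_zero fun T hT => by rw [hx T hT, sub_self, mul_zero]

theorem one_add_Usum_densityKernel (hν : ν ≪ Measure.pi μ)
    (hmarg : ∀ i, ν.map (fun x => x i) = μ i) :
    (fun x => 1 + Usum (densityKernel μ ν) x) =ᵐ[Measure.pi μ] productDensity μ ν := by
  have hS : ∀ᵐ x ∂Measure.pi μ, ∀ S : Finset (Fin n), S.card ≤ 1 → densityKernel μ ν S x = 0 :=
    ae_all_iff.2 fun S => Filter.eventually_imp_distrib_left.2 fun hS =>
      densityKernel_of_card_le_one hν hmarg hS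
  filter_upwards [hS] with x hx
  have hsum : Usum (densityKernel μ ν) x =
      ∑ S ∈ (univ : Finset (Fin n)).powerset, densityKernel μ ν S x := by
    rw [Usum, powerset_univ]
    refine sum_filter_of_ne fun S _ hne => ?_
    by_contra! h
    exact hne (hx S (by lia))
  simp only [hsum, densityKernel]
  rw [sum_powerset_sum_powerset_neg_one_pow_mul
    (fun T => coordMean μ T (productDensity μ ν) x - 1), coordMean_univ]
  ring

theorem isKernelSystem_densityKernel (hν : ν ≪ Measure.pi μ)
    (hmarg : ∀ i, ν.map (fun x => x i) = μ i) : IsKernelSystem μ (densityKernel μ ν) := by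
  refine ⟨fun S _ => ?_, ?_⟩
  · have hm : Measurable (densityKernel μ ν S) := Finset.measurable_fun_sum _ fun T _ =>
      ((measurable_coordMean T measurable_productDensity).sub_const 1).const_mul _
    refine ⟨hm, fun x y hxy => sum_congr rfl fun T hT => ?_,
      integrable_finsetSum _ fun T _ => integrable_densityKernel_term S T, fun k hk => ?_⟩
    · have hpw : ∀ z, T.piecewise x z = T.piecewise y z := by
        intro z
        ext i
        by_cases hi : i ∈ T
        · simpa [hi] using hxy i (mem_powerset.1 hT hi)
        · simp [hi]
      simp only [coordMean, hpw]
    · filter_upwards [coordMean_compl_singleton_densityKernel (μ := μ) (ν := ν) hk] with x hx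
      rwa [← coordMean_compl_singleton k hm]
  · filter_upwards [one_add_Usum_densityKernel hν hmarg] with x hx
    have : 0 ≤ productDensity μ ν x := ENNReal.toReal_nonneg
    linarith

theorem densityKernel_ae_eq_sum_marginalDensity (hν : ν ≪ Measure.pi μ)
    (hmarg : ∀ i, ν.map (fun x => x i) = μ i) (S : Finset (Fin n)) :
    densityKernel μ ν S =ᵐ[Measure.pi μ] fun x =>
      ∑ T ∈ S.powerset.filter (fun T => 2 ≤ T.card),
        (-1 : ℝ) ^ (S.card - T.card) * (marginalDensity μ ν T x - 1) := by
  have hT : ∀ᵐ x ∂Measure.pi μ, ∀ T : Finset (Fin n),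
      coordMean μ T (productDensity μ ν) x = marginalDensity μ ν T x :=
    ae_all_iff.2 coordMean_productDensity_ae_eq_marginalDensity
  have hT₁ : ∀ᵐ x ∂Measure.pi μ, ∀ T : Finset (Fin n), T.card ≤ 1 →
      coordMean μ T (productDensity μ ν) x = 1 :=
    ae_all_iff.2 fun T => Filter.eventually_imp_distrib_left.2 fun hT =>
      coordMean_productDensity_of_card_le_one hν hmarg hT
  filter_upwards [hT, hT₁] with x h h₁
  rw [densityKernel, ← sum_filter_of_ne (p := fun T => 2 ≤ T.card)]
  · refine sum_congr rfl fun T hT => ?_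
    have hle := card_le_card (mem_powerset.1 (mem_filter.1 hT).1)
    have hexp : S.card + T.card = S.card - T.card + 2 * T.card := by lia
    rw [h T, hexp, pow_add, pow_mul]
    simp
  · intro T _ hne
    by_contra! hlt
    exact hne (by rw [h₁ T (by lia), sub_self, mul_zero])

end KernelSystem

/-- Theorem 2.1: `F` is a joint cdf with one-dimensional marginal cdfs `F_k(x) = μ_k(-∞, x]`,
absolutely continuous w.r.t. the product of the marginals, if and only if there are kernels
`g_{i_1,…,i_c}` satisfying A1–A3 with
`F(x₁,…,xₙ) = ∫_{-∞}^{x₁}⋯∫_{-∞}^{xₙ} (1 + U_n(t)) dF₁(t₁)⋯dFₙ(tₙ)`.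
Moreover, the kernels are a.s. unique and are given by the inclusion–exclusion formula
`f_{i_1,…,i_c} = Σ_{k=2}^{c} (-1)^{c-k} Σ_{j_1<⋯<j_k ∈ {i_1,…,i_c}}
  (dF(x_{j_1},…,x_{j_k})/(dF_{j_1}⋯dF_{j_k}) - 1)` in terms of the marginal densities. -/
theorem statement0 (n : ℕ) (μ : Fin n → Measure ℝ) [∀ i, IsProbabilityMeasure (μ i)]
    (F : (Fin n → ℝ) → ℝ) :
    ((∃ ν : Measure (Fin n → ℝ), IsProbabilityMeasure ν ∧
        (∀ i, ν.map (fun x => x i) = μ i) ∧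
        ν ≪ Measure.pi μ ∧
        ∀ x, F x = (ν (Set.Iic x)).toReal) ↔
      ∃ g : Finset (Fin n) → (Fin n → ℝ) → ℝ, IsKernelSystem μ g ∧
        ∀ x, F x = ∫ t in Set.Iic x, (1 + Usum g t) ∂Measure.pi μ)
    ∧
    (∀ ν : Measure (Fin n → ℝ), IsProbabilityMeasure ν →
      (∀ i, ν.map (fun x => x i) = μ i) → ν ≪ Measure.pi μ →
      (∀ x, F x = (ν (Set.Iic x)).toReal) →
      ∀ g : Finset (Fin n) → (Fin n → ℝ) → ℝ, IsKernelSystem μ g →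
      (∀ x, F x = ∫ t in Set.Iic x, (1 + Usum g t) ∂Measure.pi μ) →
      ∀ S : Finset (Fin n), 2 ≤ S.card →
        g S =ᵐ[Measure.pi μ] fun x =>
          ∑ T ∈ S.powerset.filter (fun T => 2 ≤ T.card),
            (-1 : ℝ) ^ (S.card - T.card) * (marginalDensity μ ν T x - 1)) := by
  refine ⟨⟨?_, ?_⟩, ?_⟩
  · rintro ⟨ν, hprob, hmarg, hν, hF⟩
    refine ⟨densityKernel μ ν, isKernelSystem_densityKernel hν hmarg, fun x => ?_⟩
    rw [hF x, integral_congr_ae (ae_restrict_of_ae (one_add_Usum_densityKernel hν hmarg))]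
    exact (Measure.setIntegral_toReal_rnDeriv hν _).symm
  · rintro ⟨g, hg, hF⟩
    exact ⟨kernelMeasure μ g, hg.isProbabilityMeasure_kernelMeasure, hg.map_eval_kernelMeasure,
      withDensity_absolutelyContinuous _ _,
      fun x => (hF x).trans (hg.toReal_kernelMeasure_Iic x).symm⟩
  · intro ν hprob hmarg hν hFν g hg hFg S hS
    have := hg.isProbabilityMeasure_kernelMeasure
    obtain rfl : ν = kernelMeasure μ g := Measure.ext_of_Iic_pi fun x => by
      rw [← ENNReal.toReal_eq_toReal_iff' (measure_ne_top _ _) (measure_ne_top _ _), ← hFν x,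
        hFg x, hg.toReal_kernelMeasure_Iic x]
    exact (hg.ae_eq_densityKernel hS).trans
      (densityKernel_ae_eq_sum_marginalDensity hν hmarg S)
end

section
/- Random variables X_1,…,X_n with one-dimensional cdfs F_1,…,F_n whose joint cdf has the canonical representation F(x_1,…,x_n) = ∫_{−∞}^{x_1}⋯∫_{−∞}^{x_n} (1 + U_n(t_1,…,t_n)) dF_1(t_1)⋯dF_n(t_n) with kernels g satisfying A1–A3 are jointly independent if and only if g_{i_1,…,i_c}(ξ_{i_1},…,ξ_{i_c}) = 0 almost surely for all 1 ≤ i_1 < ⋯ < i_c ≤ n, c = 2,…,n. -/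
open MeasureTheory Finset

/-- Resampling the `k`-th coordinate preserves a product of probability measures. -/
theorem measurePreserving_update_pi {ι : Type*} [Fintype ι] [DecidableEq ι] {α : ι → Type*}
    [∀ i, MeasurableSpace (α i)] (μ : ∀ i, Measure (α i)) [∀ i, IsProbabilityMeasure (μ i)]
    (k : ι) :
    MeasurePreserving (fun p : (∀ i, α i) × α k => Function.update p.1 k p.2)
      ((Measure.pi μ).prod (μ k)) (Measure.pi μ) := by
  have hmeas : Measurable fun p : (∀ i, α i) × α k => Function.update p.1 k p.2 :=
    measurable_update'
  refine ⟨hmeas, (Measure.pi_eq fun s hs => ?_).symm⟩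
  have hpre : (fun p : (∀ i, α i) × α k => Function.update p.1 k p.2) ⁻¹' Set.univ.pi s =
      Set.univ.pi (Function.update s k Set.univ) ×ˢ s k := by
    ext ⟨x, t⟩
    simp only [Set.mem_preimage, Set.mem_prod, Set.mem_univ_pi]
    refine ⟨fun h => ⟨fun i => ?_, by simpa using h k⟩, fun h i => ?_⟩
    · by_cases hi : i = k
      · subst hi; simp
      · simpa [hi] using h i
    · by_cases hi : i = k
      · subst hi; simpa using h.2
      · simpa [hi] using h.1 i
  rw [Measure.map_apply hmeas (MeasurableSet.univ_pi hs), hpre, Measure.prod_prod, Measure.pi_pi,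
    ← Finset.mul_prod_erase _ _ (Finset.mem_univ k), ← Finset.mul_prod_erase _ (fun i => μ i (s i))
      (Finset.mem_univ k), Function.update_self, measure_univ, one_mul, mul_comm]
  congr 1
  refine Finset.prod_congr rfl fun i hi => ?_
  rw [Function.update_of_ne (Finset.ne_of_mem_erase hi)]

/-- If a finite family of functions, each depending only on the coordinates in its index set and
degenerate in each of them, sums to zero almost surely, then so does the subfamily of functions
not involving the coordinate `k`. -/
theorem ae_sum_filter_notMem_eq_zero {n : ℕ} {μ : Fin n → Measure ℝ}
    [∀ i, IsProbabilityMeasure (μ i)] {g : Finset (Fin n) → (Fin n → ℝ) → ℝ}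
    {F : Finset (Finset (Fin n))} (hdep : ∀ S ∈ F, DependsOnlyOn S (g S))
    (hint : ∀ S ∈ F, Integrable (g S) (Measure.pi μ))
    (hdeg : ∀ S ∈ F, ∀ k ∈ S,
      ∀ᵐ x ∂Measure.pi μ, ∫ t, g S (Function.update x k t) ∂μ k = 0)
    (hsum : ∀ᵐ x ∂Measure.pi μ, ∑ S ∈ F, g S x = 0) (k : Fin n) :
    ∀ᵐ x ∂Measure.pi μ, ∑ S ∈ F with k ∉ S, g S x = 0 := by
  have hmp := measurePreserving_update_pi μ k
  have hsum' := Measure.ae_ae_of_ae_prod (hmp.quasiMeasurePreserving.ae hsum)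
  have hint' : ∀ᵐ x ∂Measure.pi μ, ∀ S ∈ F,
      Integrable (fun t => g S (Function.update x k t)) (μ k) :=
    (ae_ball_iff F.countable_toSet).2 fun S hS =>
      (hmp.integrable_comp_of_integrable (hint S hS)).prod_right_ae
  have hdeg' : ∀ᵐ x ∂Measure.pi μ, ∀ S ∈ F, k ∈ S →
      ∫ t, g S (Function.update x k t) ∂μ k = 0 :=
    (ae_ball_iff F.countable_toSet).2 fun S hS => by
      by_cases hk : k ∈ S
      · filter_upwards [hdeg S hS k hk] with x hx _ using hx
      · exact ae_of_all _ fun x h => absurd h hk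
  filter_upwards [hsum', hint', hdeg'] with x hx hix hdx
  have hzero : ∑ S ∈ F, ∫ t, g S (Function.update x k t) ∂μ k = 0 := by
    rw [← integral_finsetSum F hix]
    exact integral_eq_zero_of_ae hx
  rw [Finset.sum_filter]
  refine (Finset.sum_congr rfl fun S hS => ?_).trans hzero
  by_cases hk : k ∈ S
  · simpa [hk] using (hdx S hS hk).symm
  · have hconst : ∀ t, g S (Function.update x k t) = g S x := fun t =>
      hdep S hS _ _ fun i hi => Function.update_of_ne (ne_of_mem_of_not_mem hi hk) _ _
    simp [hconst, hk]

/-- If a finite family of degenerate kernels sums to zero almost surely, then so does the subfamily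
of kernels involving none of the coordinates in `R`. -/
theorem ae_sum_filter_disjoint_eq_zero {n : ℕ} {μ : Fin n → Measure ℝ}
    [∀ i, IsProbabilityMeasure (μ i)] {g : Finset (Fin n) → (Fin n → ℝ) → ℝ}
    {F : Finset (Finset (Fin n))} (hdep : ∀ S ∈ F, DependsOnlyOn S (g S))
    (hint : ∀ S ∈ F, Integrable (g S) (Measure.pi μ))
    (hdeg : ∀ S ∈ F, ∀ k ∈ S,
      ∀ᵐ x ∂Measure.pi μ, ∫ t, g S (Function.update x k t) ∂μ k = 0)
    (hsum : ∀ᵐ x ∂Measure.pi μ, ∑ S ∈ F, g S x = 0) (R : Finset (Fin n)) :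
    ∀ᵐ x ∂Measure.pi μ, ∑ S ∈ F with Disjoint R S, g S x = 0 := by
  induction R using Finset.induction_on with
  | empty => simpa using hsum
  | insert k R _ ih =>
    have h := ae_sum_filter_notMem_eq_zero
      (fun S hS => hdep S (Finset.mem_of_mem_filter S hS))
      (fun S hS => hint S (Finset.mem_of_mem_filter S hS))
      (fun S hS => hdeg S (Finset.mem_of_mem_filter S hS)) ih k
    simpa only [Finset.filter_filter, Finset.disjoint_insert_left, and_comm] using h

/-- Degenerate kernels are almost surely determined by their sum: if a finite family of them sums
to zero almost surely, then each of them vanishes almost surely. -/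
theorem ae_eq_zero_of_ae_sum_eq_zero {n : ℕ} {μ : Fin n → Measure ℝ}
    [∀ i, IsProbabilityMeasure (μ i)] {g : Finset (Fin n) → (Fin n → ℝ) → ℝ}
    {F : Finset (Finset (Fin n))} (hdep : ∀ S ∈ F, DependsOnlyOn S (g S))
    (hint : ∀ S ∈ F, Integrable (g S) (Measure.pi μ))
    (hdeg : ∀ S ∈ F, ∀ k ∈ S,
      ∀ᵐ x ∂Measure.pi μ, ∫ t, g S (Function.update x k t) ∂μ k = 0)
    (hsum : ∀ᵐ x ∂Measure.pi μ, ∑ S ∈ F, g S x = 0) (S : Finset (Fin n)) (hS : S ∈ F) :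
    g S =ᵐ[Measure.pi μ] 0 := by
  induction S using Finset.strongInduction with
  | H S ih =>
    have hsub : ∀ᵐ x ∂Measure.pi μ, ∀ T ∈ F, T ⊂ S → g T x = 0 :=
      (ae_ball_iff F.countable_toSet).2 fun T hT => by
        by_cases hTS : T ⊂ S
        · filter_upwards [ih T hTS hT] with x hx _ using hx
        · exact ae_of_all _ fun x h => absurd h hTS
    filter_upwards [hsub, ae_sum_filter_disjoint_eq_zero hdep hint hdeg hsum Sᶜ] with x hx hsx
    rw [Finset.sum_eq_single_of_mem S (by simp [hS, disjoint_compl_left])] at hsx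
    · exact hsx
    · intro T hT hne
      rw [Finset.mem_filter, disjoint_compl_left_iff] at hT
      exact hx T hT.1 (lt_of_le_of_ne hT.2 hne)

/-- Theorem 5.1: random variables `X₁,…,Xₙ` with one-dimensional marginals `μ_i` whose joint
law `ν` has the canonical representation
`dF = (1 + U_n(t₁,…,tₙ)) dF₁(t₁)⋯dFₙ(tₙ)` with kernels `g` satisfying A1–A3 are jointly
independent (i.e. `ν` is the product of the marginals) if and only if all kernels vanish
almost surely. -/
theorem statement4 (n : ℕ) (μ : Fin n → Measure ℝ) [∀ i, IsProbabilityMeasure (μ i)]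
    (g : Finset (Fin n) → (Fin n → ℝ) → ℝ) (hg : IsKernelSystem μ g)
    (ν : Measure (Fin n → ℝ))
    (hrep : ν = (Measure.pi μ).withDensity fun x => ENNReal.ofReal (1 + Usum g x)) :
    ν = Measure.pi μ ↔
      ∀ S : Finset (Fin n), 2 ≤ S.card → g S =ᵐ[Measure.pi μ] 0 := by
  have hmem : ∀ S ∈ Finset.univ.filter (fun S : Finset (Fin n) => 2 ≤ S.card), 2 ≤ S.card :=
    fun S hS => (Finset.mem_filter.1 hS).2
  have hmeas : Measurable (Usum g) :=
    Finset.measurable_fun_sum _ fun S hS => (hg.1 S (hmem S hS)).1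
  have hν : ν = Measure.pi μ ↔ ∀ᵐ x ∂Measure.pi μ, Usum g x = 0 := by
    rw [hrep]
    nth_rewrite 2 [← withDensity_one (μ := Measure.pi μ)]
    rw [withDensity_eq_iff_of_sigmaFinite (by fun_prop) (by fun_prop)]
    simp only [Filter.EventuallyEq, Pi.one_apply, ENNReal.ofReal_eq_one, add_eq_left]
  rw [hν]
  refine ⟨fun h S hS => ae_eq_zero_of_ae_sum_eq_zero
    (fun S hS => (hg.1 S (hmem S hS)).2.1) (fun S hS => (hg.1 S (hmem S hS)).2.2.1)
    (fun S hS => (hg.1 S (hmem S hS)).2.2.2) h S (by simpa using hS), fun h => ?_⟩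
  have hall : ∀ᵐ x ∂Measure.pi μ,
      ∀ S ∈ Finset.univ.filter (fun S : Finset (Fin n) => 2 ≤ S.card), g S x = 0 :=
    (ae_ball_iff (Finset.countable_toSet _)).2 fun S hS => h S (hmem S hS)
  filter_upwards [hall] with x hx using Finset.sum_eq_zero hx
end

section
/- Identically distributed random variables X_1,…,X_n whose joint distribution possesses the canonical representation with kernels g satisfying A1–A3 are exchangeable if and only if g_{i_1,…,i_c}(ξ_{i_1},…,ξ_{i_c}) = g_{i_{π(1)},…,i_{π(c)}}(ξ_{i_{π(1)}},…,ξ_{i_{π(c)}}) almost surely for all 1 ≤ i_1 < ⋯ < i_c ≤ n, c = 2,…,n, and all permutations π of {1,…,n}. -/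
open MeasureTheory Finset

section CoordinateMaps

variable {n : ℕ} (μ : Fin n → Measure ℝ) [∀ i, IsProbabilityMeasure (μ i)]

/-- Resampling one coordinate independently preserves a product probability measure. -/
lemma measurePreserving_update_pi_s8 (k : Fin n) :
    MeasurePreserving (fun p : (Fin n → ℝ) × ℝ => Function.update p.1 k p.2)
      ((Measure.pi μ).prod (μ k)) (Measure.pi μ) := by
  have hm : Measurable (fun p : (Fin n → ℝ) × ℝ => Function.update p.1 k p.2) := by fun_prop
  refine ⟨hm, (Measure.pi_eq fun s hs => ?_).symm⟩
  have hpre : (fun p : (Fin n → ℝ) × ℝ => Function.update p.1 k p.2) ⁻¹' Set.univ.pi s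
      = Set.univ.pi (Function.update s k Set.univ) ×ˢ s k := by
    ext p
    simp only [Set.mem_preimage, Set.mem_pi, Set.mem_univ, true_implies, Set.mem_prod]
    constructor
    · intro h
      refine ⟨fun i => ?_, by simpa using h k⟩
      rcases eq_or_ne i k with rfl | hik
      · simp
      · simpa [hik] using h i
    · rintro ⟨h, hk⟩ i
      rcases eq_or_ne i k with rfl | hik
      · simpa using hk
      · simpa [hik] using h i
  rw [Measure.map_apply hm (MeasurableSet.univ_pi hs), hpre, Measure.prod_prod, Measure.pi_pi,
    ← Finset.prod_erase_mul _ _ (Finset.mem_univ k),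
    ← Finset.prod_erase_mul (a := k) _ (fun i => μ i (s i)) (Finset.mem_univ k)]
  simp only [Function.update_self, measure_univ, mul_one]
  congr 1
  refine Finset.prod_congr rfl fun i hi => ?_
  rw [Function.update_of_ne (Finset.ne_of_mem_erase hi)]

/-- Permuting the coordinates preserves a product of identical measures. -/
lemma measurePreserving_comp_perm (ρ : Measure ℝ) [IsProbabilityMeasure ρ]
    (π : Equiv.Perm (Fin n)) :
    MeasurePreserving (fun x : Fin n → ℝ => x ∘ π)
      (Measure.pi fun _ => ρ) (Measure.pi fun _ => ρ) := by
  have hm : Measurable (fun x : Fin n → ℝ => x ∘ π) :=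
    measurable_pi_lambda _ fun i => measurable_pi_apply (π i)
  refine ⟨hm, (Measure.pi_eq fun s hs => ?_).symm⟩
  have hpre : (fun x : Fin n → ℝ => x ∘ π) ⁻¹' Set.univ.pi s
      = Set.univ.pi fun i => s (π⁻¹ i) := by
    ext x
    simp only [Set.mem_preimage, Set.mem_pi, Set.mem_univ, true_implies, Function.comp_apply]
    exact ⟨fun h i => by simpa using h (π⁻¹ i), fun h i => by simpa using h (π i)⟩
  rw [Measure.map_apply hm (MeasurableSet.univ_pi hs), hpre, Measure.pi_pi]
  exact Equiv.prod_comp π⁻¹ fun i => ρ (s i)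

end CoordinateMaps

section Degenerate

variable {n : ℕ}

/-- The conditions A1 and A2 for a single kernel with index set `S`. -/
def IsDegenerateKernel (μ : Fin n → Measure ℝ) (S : Finset (Fin n)) (f : (Fin n → ℝ) → ℝ) :
    Prop :=
  Measurable f ∧ DependsOnlyOn S f ∧ Integrable f (Measure.pi μ) ∧
    ∀ k ∈ S, ∀ᵐ x ∂Measure.pi μ, ∫ t, f (Function.update x k t) ∂μ k = 0

/-- The σ-algebra on `ℝⁿ` generated by the coordinates in `S`. -/
abbrev coordSigma (S : Finset (Fin n)) : MeasurableSpace (Fin n → ℝ) :=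
  MeasurableSpace.comap S.restrict inferInstance

lemma coordSigma_le (S : Finset (Fin n)) : coordSigma S ≤ MeasurableSpace.pi :=
  (Finset.measurable_restrict S).comap_le

lemma DependsOnlyOn.stronglyMeasurable {S : Finset (Fin n)} {f : (Fin n → ℝ) → ℝ}
    (hf : DependsOnlyOn S f) (hm : Measurable f) : StronglyMeasurable[coordSigma S] f := by
  let ext : (S → ℝ) → Fin n → ℝ := fun y i => if h : i ∈ S then y ⟨i, h⟩ else 0
  have hext : Measurable ext := by
    refine measurable_pi_lambda _ fun i => ?_
    by_cases h : i ∈ S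
    · simpa [ext, h] using measurable_pi_apply (⟨i, h⟩ : S)
    · simp [ext, h]
  have hfac : f = (f ∘ ext) ∘ S.restrict := by
    funext x
    exact hf _ _ fun i hi => by simp [ext, hi]
  have : Measurable[coordSigma S] f := by
    rw [hfac]
    exact (hm.comp hext).comp (comap_measurable _)
  exact this.stronglyMeasurable

variable {μ : Fin n → Measure ℝ} [∀ i, IsProbabilityMeasure (μ i)]

/-- A degenerate kernel integrates to zero given any collection of coordinates
that misses one of its variables. -/
lemma IsDegenerateKernel.condExp_eq_zero {S T : Finset (Fin n)} {f : (Fin n → ℝ) → ℝ}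
    (hf : IsDegenerateKernel μ T f) (hTS : ¬ T ⊆ S) :
    (Measure.pi μ)[f | coordSigma S] =ᵐ[Measure.pi μ] 0 := by
  obtain ⟨k, hkT, hkS⟩ := Finset.not_subset.1 hTS
  obtain ⟨-, -, hint, hdeg⟩ := hf
  refine (ae_eq_condExp_of_forall_setIntegral_eq (coordSigma_le S) hint
    (fun _ _ _ => integrableOn_zero) (fun A hA _ => ?_)
    stronglyMeasurable_zero.aestronglyMeasurable).symm
  have hA' : MeasurableSet A := coordSigma_le S A hA
  have hinv : ∀ x t, Function.update x k t ∈ A ↔ x ∈ A := by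
    obtain ⟨B, -, rfl⟩ := hA
    intro x t
    have : S.restrict (Function.update x k t) = S.restrict x := by
      funext i
      have : (i : Fin n) ≠ k := fun h => hkS (h ▸ i.2)
      simp [this]
    simp [this]
  have hmp := measurePreserving_update_pi_s8 μ k
  have hind : Integrable (A.indicator f) (Measure.pi μ) := hint.indicator hA'
  have hprod : Integrable
      (fun p : (Fin n → ℝ) × ℝ => A.indicator f (Function.update p.1 k p.2))
      ((Measure.pi μ).prod (μ k)) :=
    (hmp.integrable_comp hind.aestronglyMeasurable).2 hind
  have hsection : ∀ᵐ x ∂Measure.pi μ,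
      ∫ t, A.indicator f (Function.update x k t) ∂μ k = 0 := by
    filter_upwards [hdeg k hkT] with x hx
    by_cases hxA : x ∈ A
    · simpa [Set.indicator, hinv, hxA] using hx
    · simp [Set.indicator, hinv, hxA]
  have hzero : ∫ x, A.indicator f x ∂Measure.pi μ = 0 := by
    rw [← hmp.map_eq, integral_map hmp.aemeasurable
      (by rw [hmp.map_eq]; exact hind.aestronglyMeasurable), integral_prod _ hprod]
    exact integral_eq_zero_of_ae hsection
  rw [← integral_indicator (f := f) hA', hzero]
  simp

/-- Uniqueness of the canonical decomposition: if degenerate kernels sum to zero,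
each of them vanishes almost surely. -/
lemma IsDegenerateKernel.ae_eq_zero_of_Usum {d : Finset (Fin n) → (Fin n → ℝ) → ℝ}
    (hd : ∀ S : Finset (Fin n), 2 ≤ S.card → IsDegenerateKernel μ S (d S))
    (hsum : Usum d =ᵐ[Measure.pi μ] 0) (S : Finset (Fin n)) (hS : 2 ≤ S.card) :
    d S =ᵐ[Measure.pi μ] 0 := by
  induction S using Finset.strongInduction with
  | H S ih =>
    set F := Finset.univ.filter (fun T : Finset (Fin n) => 2 ≤ T.card)
    have hF : ∀ T ∈ F, 2 ≤ T.card := fun T hT => (Finset.mem_filter.1 hT).2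
    have hSF : S ∈ F := Finset.mem_filter.2 ⟨Finset.mem_univ _, hS⟩
    have hU : Usum d = ∑ T ∈ F, d T := by
      funext x
      simp [Usum, F]
    have hE : (Measure.pi μ)[∑ T ∈ F, d T | coordSigma S] =ᵐ[Measure.pi μ] 0 := by
      rw [← hU]
      exact (condExp_congr_ae hsum).trans (by rw [condExp_zero])
    have hS' : (Measure.pi μ)[d S | coordSigma S] = d S :=
      condExp_of_stronglyMeasurable (coordSigma_le S)
        ((hd S hS).2.1.stronglyMeasurable (hd S hS).1) (hd S hS).2.2.1
    have hT : ∀ T ∈ F, T ≠ S →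
        (Measure.pi μ)[d T | coordSigma S] =ᵐ[Measure.pi μ] 0 := by
      intro T hTF hne
      by_cases hTS : T ⊆ S
      · exact (condExp_congr_ae (ih T (hTS.ssubset_of_ne hne) (hF T hTF))).trans
          (by rw [condExp_zero])
      · exact (hd T (hF T hTF)).condExp_eq_zero hTS
    have hT' : ∀ᵐ x ∂Measure.pi μ, ∀ T ∈ F, T ≠ S →
        ((Measure.pi μ)[d T | coordSigma S]) x = 0 := by
      refine (Finset.eventually_all F).2 fun T hTF => ?_
      by_cases hne : T = S
      · exact Filter.Eventually.of_forall fun x h => absurd hne h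
      · filter_upwards [hT T hTF hne] with x hx _ using hx
    filter_upwards [hE, condExp_finsetSum (μ := Measure.pi μ)
      (fun T hTF => (hd T (hF T hTF)).2.2.1) (coordSigma S), hT'] with x h1 h2 h3
    rw [h1, Finset.sum_apply, Finset.sum_eq_single_of_mem S hSF h3, hS'] at h2
    exact h2.symm

lemma IsDegenerateKernel.sub {S : Finset (Fin n)} {f f' : (Fin n → ℝ) → ℝ}
    (hf : IsDegenerateKernel μ S f) (hf' : IsDegenerateKernel μ S f') :
    IsDegenerateKernel μ S (fun x => f x - f' x) := by
  obtain ⟨hm, hdep, hint, hdeg⟩ := hf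
  obtain ⟨hm', hdep', hint', hdeg'⟩ := hf'
  refine ⟨hm.sub hm', fun x y h => ?_, hint.sub hint', fun k hk => ?_⟩
  · simp only [hdep x y h, hdep' x y h]
  · have hsec : ∀ {h : (Fin n → ℝ) → ℝ}, Integrable h (Measure.pi μ) →
        ∀ᵐ x ∂Measure.pi μ, Integrable (fun t => h (Function.update x k t)) (μ k) := by
      intro h hh
      have hmp := measurePreserving_update_pi_s8 μ k
      exact ((hmp.integrable_comp hh.aestronglyMeasurable).2 hh).prod_right_ae
    filter_upwards [hdeg k hk, hdeg' k hk, hsec hint, hsec hint'] with x h1 h2 h3 h4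
    rw [integral_sub h3 h4, h1, h2, sub_zero]

/-- Relabelling the variables of a degenerate kernel yields a degenerate kernel. -/
lemma IsDegenerateKernel.comp_perm {ρ : Measure ℝ} [IsProbabilityMeasure ρ]
    {S : Finset (Fin n)} {f : (Fin n → ℝ) → ℝ} (π : Equiv.Perm (Fin n))
    (hf : IsDegenerateKernel (fun _ => ρ) (S.image π) f) :
    IsDegenerateKernel (fun _ => ρ) S (fun x => f (x ∘ ⇑π⁻¹)) := by
  obtain ⟨hm, hdep, hint, hdeg⟩ := hf
  have hmp := measurePreserving_comp_perm ρ π⁻¹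
  refine ⟨hm.comp hmp.measurable, fun x y h => hdep _ _ fun i hi => ?_,
    (hmp.integrable_comp hint.aestronglyMeasurable).2 hint, fun k hk => ?_⟩
  · obtain ⟨j, hj, rfl⟩ := Finset.mem_image.1 hi
    simpa using h j hj
  · filter_upwards [hmp.quasiMeasurePreserving.ae
      (hdeg (π k) (Finset.mem_image_of_mem _ hk))] with x hx
    have hupd : ∀ t, Function.update x k t ∘ ⇑π⁻¹
        = Function.update (x ∘ ⇑π⁻¹) (π k) t := by
      intro t
      exact Function.update_comp_equiv x π⁻¹ k t
    simpa only [hupd] using hx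

end Degenerate

section Density

variable {n : ℕ}

lemma Usum_comp_perm (g : Finset (Fin n) → (Fin n → ℝ) → ℝ) (π : Equiv.Perm (Fin n))
    (x : Fin n → ℝ) :
    Usum (fun S x => g (S.image π) (x ∘ ⇑π⁻¹)) x = Usum g (x ∘ ⇑π⁻¹) := by
  refine Finset.sum_equiv π.finsetCongr (fun S => by simp) fun S _ => ?_
  simp [Finset.map_eq_image]

/-- Permuting the coordinates of a law with density `f` permutes the arguments of `f`. -/
lemma map_comp_perm_withDensity (ρ : Measure ℝ) [IsProbabilityMeasure ρ]
    (π : Equiv.Perm (Fin n)) {f : (Fin n → ℝ) → ENNReal} (hf : Measurable f) :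
    ((Measure.pi fun _ => ρ).withDensity f).map (fun x => x ∘ π)
      = (Measure.pi fun _ => ρ).withDensity fun x => f (x ∘ ⇑π⁻¹) := by
  have hmp := measurePreserving_comp_perm ρ π
  have hmp' := measurePreserving_comp_perm ρ π⁻¹
  ext A hA
  rw [Measure.map_apply hmp.measurable hA, withDensity_apply _ (hmp.measurable hA),
    withDensity_apply _ hA,
    ← hmp.setLIntegral_comp_preimage (f := fun x => f (x ∘ ⇑π⁻¹)) hA (hf.comp hmp'.measurable)]
  simp only [Function.comp_assoc, ← Equiv.Perm.coe_mul, mul_inv_cancel, Equiv.Perm.coe_one,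
    Function.comp_id]

/-- Invariance of the law under a permutation amounts to invariance of `Usum g`. -/
lemma IsKernelSystem.map_comp_perm_eq_iff {ρ : Measure ℝ} [IsProbabilityMeasure ρ]
    {g : Finset (Fin n) → (Fin n → ℝ) → ℝ} (hg : IsKernelSystem (fun _ => ρ) g)
    (π : Equiv.Perm (Fin n)) :
    ((Measure.pi fun _ => ρ).withDensity fun x => ENNReal.ofReal (1 + Usum g x)).map
        (fun x => x ∘ π)
      = ((Measure.pi fun _ => ρ).withDensity fun x => ENNReal.ofReal (1 + Usum g x)) ↔
    ∀ᵐ x ∂Measure.pi (fun _ => ρ), Usum g (x ∘ ⇑π⁻¹) = Usum g x := by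
  obtain ⟨hker, hpos⟩ := hg
  have hmp := measurePreserving_comp_perm ρ π⁻¹
  have hUm : Measurable (Usum g) :=
    Finset.measurable_fun_sum _ fun S hS => (hker S (Finset.mem_filter.1 hS).2).1
  have hUi : Integrable (Usum g) (Measure.pi fun _ => ρ) :=
    integrable_finsetSum _ fun S hS => (hker S (Finset.mem_filter.1 hS).2).2.2.1
  have hfm : Measurable fun x => ENNReal.ofReal (1 + Usum g x) :=
    (hUm.const_add 1).ennreal_ofReal
  have hfin : ∫⁻ x, ENNReal.ofReal (1 + Usum g x) ∂(Measure.pi fun _ => ρ) ≠ ⊤ :=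
    (((integrable_const 1).add hUi).lintegral_lt_top).ne
  rw [map_comp_perm_withDensity ρ π hfm, eq_comm,
    withDensity_eq_iff (g := fun x => ENNReal.ofReal (1 + Usum g (x ∘ ⇑π⁻¹)))
      hfm.aemeasurable (hfm.comp hmp.measurable).aemeasurable hfin]
  constructor
  · intro h
    filter_upwards [h, hpos, hmp.quasiMeasurePreserving.ae hpos] with x hx h1 h2
    have := (ENNReal.ofReal_eq_ofReal_iff (by linarith) (by linarith)).1 hx
    linarith
  · intro h
    filter_upwards [h] with x hx
    rw [hx]

end Density

/-- Theorem 5.5: identically distributed random variables `X₁,…,Xₙ` (common marginal `μ`)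
whose joint law `ν` has the canonical representation with kernels `g` satisfying A1–A3 are
exchangeable (every permutation `(X_{π(1)},…,X_{π(n)})` has the same joint distribution) if
and only if the kernels are invariant under permutations of the indices:
`g_{i₁,…,i_c}(ξ_{i₁},…,ξ_{i_c}) = g_{π(i₁),…,π(i_c)}(ξ_{i₁},…,ξ_{i_c})` a.s.
(the kernel for the permuted index set, with the value `x i` placed at position `π i`). -/
theorem statement8 (n : ℕ) (μ : Measure ℝ) [IsProbabilityMeasure μ]
    (g : Finset (Fin n) → (Fin n → ℝ) → ℝ)
    (hg : IsKernelSystem (fun _ : Fin n => μ) g)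
    (ν : Measure (Fin n → ℝ))
    (hrep : ν = (Measure.pi fun _ : Fin n => μ).withDensity
      fun x => ENNReal.ofReal (1 + Usum g x)) :
    (∀ π : Equiv.Perm (Fin n), ν.map (fun x => x ∘ π) = ν) ↔
      (∀ S : Finset (Fin n), 2 ≤ S.card → ∀ π : Equiv.Perm (Fin n),
        ∀ᵐ x ∂Measure.pi (fun _ : Fin n => μ),
          g (S.image π) (fun i => x (π⁻¹ i)) = g S x) := by
  subst hrep
  simp only [hg.map_comp_perm_eq_iff]
  constructor
  · intro h S hS π
    have hd : ∀ T : Finset (Fin n), 2 ≤ T.card → IsDegenerateKernel (fun _ => μ) T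
        (fun x => g (T.image π) (x ∘ ⇑π⁻¹) - g T x) := fun T hT =>
      (IsDegenerateKernel.comp_perm π
        (hg.1 _ (by rwa [Finset.card_image_of_injective _ π.injective]))).sub (hg.1 T hT)
    have hsum : Usum (fun T x => g (T.image π) (x ∘ ⇑π⁻¹) - g T x)
        =ᵐ[Measure.pi fun _ => μ] 0 := by
      filter_upwards [h π] with x hx
      rw [← Usum_comp_perm, ← sub_eq_zero] at hx
      simpa [Usum, Finset.sum_sub_distrib] using hx
    filter_upwards [IsDegenerateKernel.ae_eq_zero_of_Usum hd hsum S hS] with x hx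
    exact sub_eq_zero.1 hx
  · intro h π
    have hall : ∀ᵐ x ∂Measure.pi (fun _ : Fin n => μ),
        ∀ S ∈ Finset.univ.filter (fun S : Finset (Fin n) => 2 ≤ S.card),
          g (S.image π) (x ∘ ⇑π⁻¹) = g S x :=
      (Finset.eventually_all _).2 fun S hS => h S (Finset.mem_filter.1 hS).2 π
    filter_upwards [hall] with x hx
    rw [← Usum_comp_perm]
    exact Finset.sum_congr rfl hx
end
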